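/- arXiv:1603.00331 — 16 statements merged into one kernel-verified Lean document; each statement's English description precedes it below -/
import Mathlib

section
/- In the projective special linear group PSL(2, F_13) (the quotient of SL(2, Z/13Z) by its center, a simple group of order 1092), there exist elements x, y, z of orders exactly 2, 3, and 7 respectively such that x·y·z = 1 and x, y, z generate the whole group. -/
namespace Matrix.SpecialLinearGroup

variable {F : Type*} [Field F]

/-- The upper unitriangular matrix with off-diagonal entry `t`. -/
def upperUnitriangular (t : F) : SpecialLinearGroup (Fin 2) F :=
  ⟨!![1, t; 0, 1], by simp [Matrix.det_fin_two]⟩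

@[simp]
theorem coe_upperUnitriangular (t : F) :
    (upperUnitriangular t : Matrix (Fin 2) (Fin 2) F) = !![1, t; 0, 1] := rfl

/-- The lower unitriangular matrix with off-diagonal entry `t`. -/
def lowerUnitriangular (t : F) : SpecialLinearGroup (Fin 2) F :=
  ⟨!![1, 0; t, 1], by simp [Matrix.det_fin_two]⟩

@[simp]
theorem coe_lowerUnitriangular (t : F) :
    (lowerUnitriangular t : Matrix (Fin 2) (Fin 2) F) = !![1, 0; t, 1] := rfl

theorem upperUnitriangular_pow (t : F) (n : ℕ) :
    upperUnitriangular t ^ n = upperUnitriangular (n * t) := by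
  induction n with
  | zero => ext i j; fin_cases i <;> fin_cases j <;> simp
  | succ n ih =>
    rw [pow_succ, ih]
    ext i j
    fin_cases i <;> fin_cases j <;>
      simp [Matrix.mul_apply, Fin.sum_univ_two]
    ring

theorem lowerUnitriangular_pow (t : F) (n : ℕ) :
    lowerUnitriangular t ^ n = lowerUnitriangular (n * t) := by
  induction n with
  | zero => ext i j; fin_cases i <;> fin_cases j <;> simp
  | succ n ih =>
    rw [pow_succ, ih]
    ext i j
    fin_cases i <;> fin_cases j <;>
      simp [Matrix.mul_apply, Fin.sum_univ_two]
    ring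

theorem eq_upper_mul_lower_mul_upper (g : SpecialLinearGroup (Fin 2) F) (hc : g 1 0 ≠ 0) :
    g = upperUnitriangular ((g 0 0 - 1) / g 1 0) * lowerUnitriangular (g 1 0) *
      upperUnitriangular ((g 1 1 - 1) / g 1 0) := by
  have hdet : g 0 0 * g 1 1 - g 0 1 * g 1 0 = 1 := by
    rw [← Matrix.det_fin_two, g.det_coe]
  ext i j
  fin_cases i <;> fin_cases j <;>
    simp [Matrix.mul_apply, Fin.sum_univ_two] <;>
    field_simp <;> first | linear_combination -hdet | ring

/-- A subgroup of `SL(2, F)` containing all upper and lower unitriangular matrices is everything. -/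
theorem eq_top_of_unitriangular_mem (H : Subgroup (SpecialLinearGroup (Fin 2) F))
    (hU : ∀ t, upperUnitriangular t ∈ H) (hL : ∀ t, lowerUnitriangular t ∈ H) : H = ⊤ := by
  have key (g : SpecialLinearGroup (Fin 2) F) (hc : g 1 0 ≠ 0) : g ∈ H := by
    rw [eq_upper_mul_lower_mul_upper g hc]
    exact H.mul_mem (H.mul_mem (hU _) (hL _)) (hU _)
  refine (Subgroup.eq_top_iff' H).2 fun g => ?_
  by_cases hc : g 1 0 = 0
  · refine (H.mul_mem_cancel_left (hL 1)).1 (key _ ?_)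
    have hdet : g 0 0 * g 1 1 - g 0 1 * g 1 0 = 1 := by
      rw [← Matrix.det_fin_two, g.det_coe]
    intro h
    simp [Matrix.mul_apply, Fin.sum_univ_two, hc] at h
    simp [h, hc] at hdet
  · exact key g hc

/-- Over a prime field, `SL(2)` is generated by the two elementary matrices with entry `1`. -/
theorem eq_top_of_unitriangular_one_mem {p : ℕ} [Fact p.Prime]
    (H : Subgroup (SpecialLinearGroup (Fin 2) (ZMod p)))
    (hU : upperUnitriangular 1 ∈ H) (hL : lowerUnitriangular 1 ∈ H) : H = ⊤ := by
  refine eq_top_of_unitriangular_mem H (fun t => ?_) (fun t => ?_)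
  · simpa [upperUnitriangular_pow] using H.pow_mem hU t.val
  · simpa [lowerUnitriangular_pow] using H.pow_mem hL t.val

end Matrix.SpecialLinearGroup

namespace PSL213

open Matrix.SpecialLinearGroup

instance : Fact (Nat.Prime 13) := ⟨by norm_num⟩

/-- A lift to `SL(2, 13)` of the generator of order two. -/
def liftX : Matrix.SpecialLinearGroup (Fin 2) (ZMod 13) :=
  ⟨!![0, 1; 12, 0], by decide⟩

/-- A lift to `SL(2, 13)` of the generator of order three. -/
def liftY : Matrix.SpecialLinearGroup (Fin 2) (ZMod 13) :=
  ⟨!![2, 6; 1, 10], by decide⟩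

theorem closure_lift :
    Subgroup.closure {liftX, liftY} = ⊤ := by
  have hX : liftX ∈ Subgroup.closure {liftX, liftY} := Subgroup.subset_closure (by simp)
  have hY : liftY ∈ Subgroup.closure {liftX, liftY} := Subgroup.subset_closure (by simp)
  apply eq_top_of_unitriangular_one_mem
  · have h : upperUnitriangular 1 = liftX * liftY * (liftX * liftY ^ 2) * (liftX * liftY ^ 2) := by
      decide +kernel
    rw [h]
    exact mul_mem (mul_mem (mul_mem hX hY) (mul_mem hX (pow_mem hY 2)))
      (mul_mem hX (pow_mem hY 2))
  · have h : lowerUnitriangular 1 = liftX ^ 3 * liftY * (liftX * liftY) * (liftX * liftY ^ 2) := by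
      decide +kernel
    rw [h]
    exact mul_mem (mul_mem (mul_mem (pow_mem hX 3) hY) (mul_mem hX hY))
      (mul_mem hX (pow_mem hY 2))

theorem orderOf_mk_eq_prime {G : Type*} [Group G] {p : ℕ} [Fact p.Prime] {g h : G}
    (hp : g ^ p ∈ Subgroup.center G) (hg : h * g ≠ g * h) :
    orderOf (g : G ⧸ Subgroup.center G) = p := by
  refine orderOf_eq_prime ?_ fun h1 => ?_
  · rwa [← QuotientGroup.mk_pow, QuotientGroup.eq_one_iff]
  · exact hg (Subgroup.mem_center_iff.1 ((QuotientGroup.eq_one_iff g).1 h1) h)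

theorem liftX_sq_mem_center :
    liftX ^ 2 ∈ Subgroup.center (Matrix.SpecialLinearGroup (Fin 2) (ZMod 13)) := by
  have h : liftX ^ 2 = -1 := by decide +kernel
  rw [h, Subgroup.mem_center_iff]
  simp

end PSL213

open PSL213 in
/-- In PSL(2, F_13), the quotient of SL(2, Z/13Z) by its center, there exist elements
x, y, z of orders exactly 2, 3, 7 with x*y*z = 1 generating the whole group. -/
theorem psl_2_13_generating_vector_2_3_7 :
    ∃ x y z : Matrix.SpecialLinearGroup (Fin 2) (ZMod 13) ⧸
        Subgroup.center (Matrix.SpecialLinearGroup (Fin 2) (ZMod 13)),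
      orderOf x = 2 ∧ orderOf y = 3 ∧ orderOf z = 7 ∧
      x * y * z = 1 ∧ Subgroup.closure {x, y, z} = ⊤ := by
  have : Fact (Nat.Prime 7) := ⟨by norm_num⟩
  refine ⟨liftX, liftY, ((liftX * liftY : Matrix.SpecialLinearGroup (Fin 2) (ZMod 13)) : _ ⧸ _)⁻¹,
    orderOf_mk_eq_prime (h := liftY) liftX_sq_mem_center (by decide +kernel),
    orderOf_mk_eq_prime (h := liftX) ?_ (by decide +kernel), ?_, ?_, ?_⟩
  · have h : liftY ^ 3 = 1 := by decide +kernel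
    exact h ▸ one_mem _
  · rw [orderOf_inv]
    have h : (liftX * liftY) ^ 7 = 1 := by decide +kernel
    exact orderOf_mk_eq_prime (h := liftX) (h ▸ one_mem _) (by decide +kernel)
  · rw [QuotientGroup.mk_mul, mul_inv_cancel]
  · have h := congrArg (Subgroup.map (QuotientGroup.mk' (Subgroup.center _))) closure_lift
    rw [MonoidHom.map_closure, Subgroup.map_top_of_surjective _ (QuotientGroup.mk'_surjective _),
      Set.image_pair] at h
    refine top_le_iff.1 (h.ge.trans (Subgroup.closure_mono ?_))
    rintro _ (rfl | rfl) <;> simp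
end

section
/- In the projective general linear group PGL(2, F_7) (the quotient of GL(2, Z/7Z) by its center, a group of order 336), there exist elements x, y, z of orders exactly 2, 6, and 8 respectively such that x·y·z = 1 and x, y, z generate the whole group. -/
open Matrix

/-- Over a field, the invertible diagonal matrices and the transvections generate the general
linear group. -/
lemma Matrix.GeneralLinearGroup.eq_top_of_diagonal_mem_of_transvection_mem {n K : Type*}
    [Fintype n] [DecidableEq n] [Field K] (H : Subgroup (GL n K))
    (hdiag : ∀ D : n → K, (∀ i, D i ≠ 0) → diagonal D ∈ H.toSubmonoid.map (Units.coeHom _))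
    (htrans : ∀ i j, i ≠ j → ∀ c : K,
      transvection i j c ∈ H.toSubmonoid.map (Units.coeHom (Matrix n n K))) :
    H = ⊤ := by
  refine (Subgroup.eq_top_iff' H).2 fun g ↦ ?_
  obtain ⟨h, hh, hg⟩ : g.val ∈ H.toSubmonoid.map (Units.coeHom (Matrix n n K)) := by
    refine diagonal_transvection_induction_of_det_ne_zero _ g.val g.det_ne_zero
      (fun D hD ↦ hdiag D ?_) (fun t ↦ htrans t.i t.j t.hij t.c) fun A B _ _ hA hB ↦ mul_mem hA hB
    simpa [det_diagonal, Finset.prod_ne_zero_iff] using hD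
  rwa [← show h = g from Units.ext hg]

/-- Transvections with parameter in `ZMod p` are powers of the one with parameter `1`. -/
lemma Matrix.transvection_mem_of_transvection_one_mem {n : Type*} [Fintype n] [DecidableEq n]
    {p : ℕ} [NeZero p] {N : Submonoid (Matrix n n (ZMod p))} {i j : n} (hij : i ≠ j)
    (h : transvection i j 1 ∈ N) (c : ZMod p) : transvection i j c ∈ N := by
  have key (k : ℕ) : transvection i j (k : ZMod p) ∈ N := by
    induction k with
    | zero => simp
    | succ k ih =>
      rw [Nat.cast_succ, ← transvection_mul_transvection_same _ _ hij]
      exact mul_mem ih h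
  simpa using key c.val

lemma Matrix.GeneralLinearGroup.mem_center_fin_two_iff {R : Type*} [CommRing R]
    {g : GL (Fin 2) R} :
    g ∈ Subgroup.center (GL (Fin 2) R) ↔
      g.val 0 1 = 0 ∧ g.val 1 0 = 0 ∧ g.val 0 0 = g.val 1 1 := by
  rw [mem_center_iff_val_mem_range_scalar]
  constructor
  · rintro ⟨a, ha⟩
    simp [← ha]
  · rintro ⟨h₁, h₂, h₃⟩
    refine ⟨g.val 0 0, ?_⟩
    ext i j
    fin_cases i <;> fin_cases j <;> simp [h₁, h₂, h₃]

namespace PGLTwoSeven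

lemma fact_prime_seven : Fact (Nat.Prime 7) := ⟨by norm_num⟩

attribute [local instance] fact_prime_seven

/-- A matrix whose image in `PGL(2, 7)` is an involution. -/
def involution : GL (Fin 2) (ZMod 7) :=
  ⟨!![1, 1; 2, -1], !![5, 5; 3, 2], by decide, by decide⟩

/-- A diagonal matrix whose image in `PGL(2, 7)` generates a split torus. -/
def torusGenerator : GL (Fin 2) (ZMod 7) :=
  ⟨!![3, 0; 0, 1], !![5, 0; 0, 1], by decide, by decide⟩

lemma eq_top_of_center_le {H : Subgroup (GL (Fin 2) (ZMod 7))} (hc : Subgroup.center _ ≤ H)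
    (hx : involution ∈ H) (hy : torusGenerator ∈ H) : H = ⊤ := by
  set N := H.toSubmonoid.map (Units.coeHom (Matrix (Fin 2) (Fin 2) (ZMod 7)))
  have hxN : !![1, 1; 2, -1] ∈ N := ⟨_, hx, rfl⟩
  have hyN : !![3, 0; 0, 1] ∈ N := ⟨_, hy, rfl⟩
  have hscalar (c : ZMod 7) (h0 : c ≠ 0) : scalar (Fin 2) c ∈ N := by
    refine ⟨GeneralLinearGroup.scalar (Fin 2) (Units.mk0 c h0), hc ?_, rfl⟩
    rw [GeneralLinearGroup.center_eq_range_scalar]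
    exact ⟨_, rfl⟩
  have hdiag (a b : ZMod 7) (ha : a ≠ 0) (hb : b ≠ 0) : !![a, 0; 0, b] ∈ N := by
    obtain ⟨k, c, h0, h⟩ : ∃ k : Fin 6, ∃ c : ZMod 7, c ≠ 0 ∧
        !![a, 0; 0, b] = scalar (Fin 2) c * !![3, 0; 0, 1] ^ k.val := by
      revert a b
      decide +kernel
    rw [h]
    exact mul_mem (hscalar c h0) (pow_mem hyN _)
  have hdiag' (a b : ZMod 7) (h : a ≠ 0 ∧ b ≠ 0) : !![a, 0; 0, b] ∈ N := hdiag a b h.1 h.2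
  have h₁ : !![0, 4; 1, 4] ∈ N := by
    rw [show (!![0, 4; 1, 4] : Matrix (Fin 2) (Fin 2) (ZMod 7)) =
      !![1, 1; 2, -1] * !![5, 0; 0, 1] * !![1, 1; 2, -1] by decide]
    exact mul_mem (mul_mem hxN (hdiag' _ _ (by decide))) hxN
  have h₂ : !![5, 2; 4, 0] ∈ N := by
    rw [show (!![5, 2; 4, 0] : Matrix (Fin 2) (Fin 2) (ZMod 7)) =
      !![1, 1; 2, -1] * !![3, 0; 0, 1] * !![1, 1; 2, -1] by decide]
    exact mul_mem (mul_mem hxN hyN) hxN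
  have hupper : transvection 0 1 1 ∈ N := by
    rw [show (transvection 0 1 1 : Matrix (Fin 2) (Fin 2) (ZMod 7)) =
      !![-1, 0; 0, 2] * (!![5, 2; 4, 0] * !![2, 0; 0, 1] * !![0, 4; 1, 4]) * !![3, 0; 0, 1] by
        decide]
    exact mul_mem (mul_mem (hdiag' _ _ (by decide))
      (mul_mem (mul_mem h₂ (hdiag' _ _ (by decide))) h₁)) hyN
  have hlower : transvection 1 0 1 ∈ N := by
    rw [show (transvection 1 0 1 : Matrix (Fin 2) (Fin 2) (ZMod 7)) =
      !![5, 0; 0, 2] * (!![0, 4; 1, 4] * !![2, 0; 0, 1] * !![5, 2; 4, 0]) * !![5, 0; 0, 1] by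
        decide]
    exact mul_mem (mul_mem (hdiag' _ _ (by decide))
      (mul_mem (mul_mem h₁ (hdiag' _ _ (by decide))) h₂)) (hdiag' _ _ (by decide))
  refine GeneralLinearGroup.eq_top_of_diagonal_mem_of_transvection_mem H (fun D hD ↦ ?_)
    fun i j hij c ↦ transvection_mem_of_transvection_one_mem hij ?_ c
  · rw [show diagonal D = !![D 0, 0; 0, D 1] by
      ext i j; fin_cases i <;> fin_cases j <;> simp]
    exact hdiag _ _ (hD 0) (hD 1)
  · fin_cases i <;> fin_cases j
    · exact absurd rfl hij
    · exact hupper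
    · exact hlower
    · exact absurd rfl hij

lemma mk_pow_eq_one_iff (g : GL (Fin 2) (ZMod 7)) (k : ℕ) :
    (g : GL (Fin 2) (ZMod 7) ⧸ Subgroup.center (GL (Fin 2) (ZMod 7))) ^ k = 1 ↔
      (g.val ^ k) 0 1 = 0 ∧ (g.val ^ k) 1 0 = 0 ∧ (g.val ^ k) 0 0 = (g.val ^ k) 1 1 := by
  rw [← QuotientGroup.mk_pow, QuotientGroup.eq_one_iff,
    GeneralLinearGroup.mem_center_fin_two_iff, Units.val_pow_eq_pow_val]

end PGLTwoSeven

open PGLTwoSeven in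
/-- In PGL(2, F_7), the quotient of GL(2, Z/7Z) by its center, there exist elements
x, y, z of orders exactly 2, 6, 8 with x*y*z = 1 generating the whole group. -/
theorem pgl_2_7_generating_vector_2_6_8 :
    ∃ x y z : Matrix.GeneralLinearGroup (Fin 2) (ZMod 7) ⧸
        Subgroup.center (Matrix.GeneralLinearGroup (Fin 2) (ZMod 7)),
      orderOf x = 2 ∧ orderOf y = 6 ∧ orderOf z = 8 ∧
      x * y * z = 1 ∧ Subgroup.closure {x, y, z} = ⊤ := by
  refine ⟨involution, torusGenerator, (↑(involution * torusGenerator))⁻¹, ?_, ?_, ?_, ?_, ?_⟩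
  · refine (orderOf_eq_iff (by norm_num)).2 ⟨?_, fun m hm hm0 ↦ ?_⟩
    · rw [mk_pow_eq_one_iff]; decide +kernel
    · rw [Ne, mk_pow_eq_one_iff]; interval_cases m; decide +kernel
  · refine (orderOf_eq_iff (by norm_num)).2 ⟨?_, fun m hm hm0 ↦ ?_⟩
    · rw [mk_pow_eq_one_iff]; decide +kernel
    · rw [Ne, mk_pow_eq_one_iff]; interval_cases m <;> decide +kernel
  · rw [orderOf_inv]
    refine orderOf_eq_prime_pow (p := 2) (n := 2) ?_ ?_
    · rw [mk_pow_eq_one_iff]; decide +kernel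
    · rw [mk_pow_eq_one_iff]; decide +kernel
  · rw [QuotientGroup.mk_mul, mul_inv_cancel]
  · refine Subgroup.comap_injective
      (QuotientGroup.mk'_surjective (Subgroup.center (GL (Fin 2) (ZMod 7)))) ?_
    rw [Subgroup.comap_top]
    refine eq_top_of_center_le ?_ ?_ ?_
    · exact QuotientGroup.le_comap_mk' _ _
    · exact Subgroup.subset_closure (by simp)
    · exact Subgroup.subset_closure (by simp)
end

section
/- In the projective special linear group PSL(2, F_11) (the quotient of SL(2, Z/11Z) by its center, a simple group of order 660), there exist elements x, y, z of orders exactly 2, 3, and 11 respectively such that x·y·z = 1 and x, y, z generate the whole group. -/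
open Matrix MatrixGroups in
/-- The elementary unipotent matrix with upper right entry `b`. -/
def upperUnipotent {R : Type*} [CommRing R] (b : R) : SL(2, R) :=
  ⟨!![1, b; 0, 1], by simp [det_fin_two_of]⟩

open Matrix MatrixGroups in
/-- The Weyl element of `SL(2, R)`. -/
def weylElement (R : Type*) [CommRing R] : SL(2, R) :=
  ⟨!![0, -1; 1, 0], by simp [det_fin_two_of]⟩

@[simp]
theorem coe_upperUnipotent {R : Type*} [CommRing R] (b : R) :
    (upperUnipotent b : Matrix (Fin 2) (Fin 2) R) = !![1, b; 0, 1] := rfl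

@[simp]
theorem coe_weylElement (R : Type*) [CommRing R] :
    (weylElement R : Matrix (Fin 2) (Fin 2) R) = !![0, -1; 1, 0] := rfl

@[simp]
theorem upperUnipotent_zero {R : Type*} [CommRing R] : upperUnipotent (0 : R) = 1 := by
  ext i j
  fin_cases i <;> fin_cases j <;> simp

theorem upperUnipotent_pow {R : Type*} [CommRing R] (b : R) (n : ℕ) :
    upperUnipotent b ^ n = upperUnipotent (n * b) := by
  induction n with
  | zero => simp
  | succ n ih =>
    rw [pow_succ, ih]
    ext i j
    fin_cases i <;> fin_cases j <;> simp [Matrix.mul_apply]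
    ring

open MatrixGroups in
/-- Over a field, a matrix whose lower left entry is nonzero factors through the two big-cell
unipotents and a conjugate of one by the Weyl element. -/
theorem eq_upperUnipotent_mul_of_apply_one_zero_ne_zero {F : Type*} [Field F] (g : SL(2, F))
    (hc : g 1 0 ≠ 0) :
    g = upperUnipotent ((g 0 0 - 1) / g 1 0) *
      (weylElement F * upperUnipotent (-g 1 0) * (weylElement F)⁻¹) *
      upperUnipotent ((g 1 1 - 1) / g 1 0) := by
  have hdet := g.det_coe
  rw [Matrix.det_fin_two] at hdet
  ext i j
  fin_cases i <;> fin_cases j <;> simp [Matrix.adjugate_fin_two] <;> field_simp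
  all_goals first | ring1 | linear_combination -hdet

open MatrixGroups in
theorem eq_top_of_weylElement_mem_of_upperUnipotent_mem {F : Type*} [Field F]
    (H : Subgroup SL(2, F)) (hw : weylElement F ∈ H) (hu : ∀ b : F, upperUnipotent b ∈ H) :
    H = ⊤ := by
  have big_cell : ∀ g : SL(2, F), g 1 0 ≠ 0 → g ∈ H := fun g hg => by
    rw [eq_upperUnipotent_mul_of_apply_one_zero_ne_zero g hg]
    exact H.mul_mem (H.mul_mem (hu _) (H.mul_mem (H.mul_mem hw (hu _)) (H.inv_mem hw))) (hu _)
  refine (Subgroup.eq_top_iff' H).2 fun g => ?_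
  by_cases hg : g 1 0 = 0
  · refine (H.mul_mem_cancel_left hw).1 (big_cell _ fun h => ?_)
    have hdet := g.det_coe
    have ha : g 0 0 = 0 := by
      simpa [Matrix.mul_apply] using h
    rw [Matrix.det_fin_two, ha, hg] at hdet
    simp at hdet
  · exact big_cell g hg

open MatrixGroups in
theorem closure_weylElement_upperUnipotent_eq_top (p : ℕ) [Fact p.Prime] :
    Subgroup.closure {weylElement (ZMod p), upperUnipotent (1 : ZMod p)} = ⊤ := by
  refine eq_top_of_weylElement_mem_of_upperUnipotent_mem _
    (Subgroup.subset_closure (by simp)) fun b => ?_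
  have h := upperUnipotent_pow (1 : ZMod p) b.val
  rw [ZMod.natCast_zmod_val, mul_one] at h
  exact h ▸ Subgroup.pow_mem _ (Subgroup.subset_closure (by simp)) _

open MatrixGroups in
theorem neg_one_mem_center_SL2 (R : Type*) [CommRing R] :
    (-1 : SL(2, R)) ∈ Subgroup.center SL(2, R) :=
  Subgroup.mem_center_iff.2 fun g => by simp

open MatrixGroups in
theorem quotient_center_mk_ne_one_of_apply_zero_one_ne_zero {R : Type*} [CommRing R] {g : SL(2, R)}
    (hg : g 0 1 ≠ 0) : (g : SL(2, R) ⧸ Subgroup.center SL(2, R)) ≠ 1 := by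
  rw [Ne, QuotientGroup.eq_one_iff, Matrix.SpecialLinearGroup.mem_center_iff]
  rintro ⟨r, -, hr⟩
  exact hg (by simp [← hr])

open MatrixGroups in
theorem weylElement_sq (R : Type*) [CommRing R] : weylElement R ^ 2 = -1 := by
  ext i j
  fin_cases i <;> fin_cases j <;> simp [sq]

open MatrixGroups in
theorem weylElement_mul_upperUnipotent_one_pow_three (R : Type*) [CommRing R] :
    (weylElement R * upperUnipotent 1) ^ 3 = -1 := by
  ext i j
  fin_cases i <;> fin_cases j <;> simp [pow_succ]

/-- In PSL(2, F_11), the quotient of SL(2, Z/11Z) by its center, there exist elements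
x, y, z of orders exactly 2, 3, 11 with x*y*z = 1 generating the whole group. -/
theorem psl_2_11_generating_vector_2_3_11 :
    ∃ x y z : Matrix.SpecialLinearGroup (Fin 2) (ZMod 11) ⧸
        Subgroup.center (Matrix.SpecialLinearGroup (Fin 2) (ZMod 11)),
      orderOf x = 2 ∧ orderOf y = 3 ∧ orderOf z = 11 ∧
      x * y * z = 1 ∧ Subgroup.closure {x, y, z} = ⊤ := by
  have : Fact (Nat.Prime 11) := ⟨by norm_num⟩
  let q := QuotientGroup.mk' (Subgroup.center (Matrix.SpecialLinearGroup (Fin 2) (ZMod 11)))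
  have q_neg_one : q (-1) = 1 :=
    (QuotientGroup.eq_one_iff _).2 (neg_one_mem_center_SL2 (ZMod 11))
  let S := weylElement (ZMod 11)
  let T := upperUnipotent (1 : ZMod 11)
  have hS : q S ^ 2 = 1 := by rw [← map_pow, weylElement_sq, q_neg_one]
  refine ⟨q S, q (S * T), (q T)⁻¹, orderOf_eq_prime hS ?_, orderOf_eq_prime ?_ ?_, ?_, ?_, ?_⟩
  · exact quotient_center_mk_ne_one_of_apply_zero_one_ne_zero (by simp [S])
  · rw [← map_pow, weylElement_mul_upperUnipotent_one_pow_three, q_neg_one]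
  · exact quotient_center_mk_ne_one_of_apply_zero_one_ne_zero (by simp [S, T])
  · rw [orderOf_inv]
    refine orderOf_eq_prime ?_ ?_
    · rw [← map_pow, upperUnipotent_pow, CharP.cast_eq_zero, zero_mul, upperUnipotent_zero,
        map_one]
    · exact quotient_center_mk_ne_one_of_apply_zero_one_ne_zero (by simp [T])
  · rw [map_mul, ← mul_assoc, ← sq, hS, one_mul, mul_inv_cancel]
  · rw [← top_le_iff, ← Subgroup.map_top_of_surjective q (QuotientGroup.mk'_surjective _),
      ← closure_weylElement_upperUnipotent_eq_top 11, MonoidHom.map_closure, Subgroup.closure_le]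
    rintro _ ⟨_, rfl | rfl, rfl⟩
    · exact Subgroup.subset_closure (by simp [S])
    · exact inv_mem_iff.1 (Subgroup.subset_closure (by simp [T]))
end

section
/- In SL(2, F_8), the special linear group of 2×2 matrices of determinant 1 over the field with 8 elements (equal to PSL(2,8), a simple group of order 504), there exist elements x, y, z of orders exactly 2, 3, and 9 respectively such that x·y·z = 1 and x, y, z generate the whole group. -/
open Matrix

namespace SL28

variable {K : Type*} [Field K]

/-- The upper unitriangular matrix with off-diagonal entry `t`. -/
def upper (t : K) : SpecialLinearGroup (Fin 2) K := ⟨!![1, t; 0, 1], by simp⟩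

@[simp]
theorem coe_upper (t : K) : (upper t : Matrix (Fin 2) (Fin 2) K) = !![1, t; 0, 1] := rfl

theorem upper_mul_upper (s t : K) : upper s * upper t = upper (s + t) := by
  ext i j
  fin_cases i <;> fin_cases j <;> simp [add_comm]

/-- In characteristic two, the matrix exchanging the two basis vectors. -/
def swap (h2 : (2 : K) = 0) : SpecialLinearGroup (Fin 2) K :=
  ⟨!![0, 1; 1, 0], by rw [det_fin_two_of]; linear_combination -h2⟩

@[simp]
theorem coe_swap (h2 : (2 : K) = 0) :
    (swap h2 : Matrix (Fin 2) (Fin 2) K) = !![0, 1; 1, 0] := rfl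

/-- The element of order three in the generating vector; `a` is a root of `X ^ 3 + X + 1`. -/
def triple (h2 : (2 : K) = 0) {a : K} (ha : a ^ 3 = a + 1) : SpecialLinearGroup (Fin 2) K :=
  ⟨!![a ^ 2 + a, a ^ 2 + a; a ^ 2, a ^ 2 + a + 1], by rw [det_fin_two_of]; grind⟩

@[simp]
theorem coe_triple (h2 : (2 : K) = 0) {a : K} (ha : a ^ 3 = a + 1) :
    (triple h2 ha : Matrix (Fin 2) (Fin 2) K) =
      !![a ^ 2 + a, a ^ 2 + a; a ^ 2, a ^ 2 + a + 1] := rfl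

theorem closure_eq_top_of_upper_mem (h2 : (2 : K) = 0)
    (H : Subgroup (SpecialLinearGroup (Fin 2) K)) (hs : swap h2 ∈ H)
    (hu : ∀ t, upper t ∈ H) : H = ⊤ := by
  have of_ne (g : SpecialLinearGroup (Fin 2) K) (hg : g 1 0 ≠ 0) : g ∈ H := by
    have hdet : g 0 0 * g 1 1 - g 0 1 * g 1 0 = 1 := by rw [← det_fin_two]; exact g.2
    have key : g = upper ((g 0 0 - 1) / g 1 0) * (swap h2 * upper (g 1 0) * swap h2) *
        upper ((g 1 1 - 1) / g 1 0) := by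
      ext i j
      fin_cases i <;> fin_cases j <;> simp <;> field_simp <;> grind
    rw [key]
    exact H.mul_mem (H.mul_mem (hu _) (H.mul_mem (H.mul_mem hs (hu _)) hs)) (hu _)
  refine (Subgroup.eq_top_iff' H).2 fun g => ?_
  by_cases hg : g 1 0 = 0
  · have hdet : g 0 0 * g 1 1 - g 0 1 * g 1 0 = 1 := by rw [← det_fin_two]; exact g.2
    refine (Subgroup.mul_mem_cancel_left H hs).1 (of_ne (swap h2 * g) ?_)
    have h0 : g 0 0 ≠ 0 := by
      rintro h
      simp [h, hg] at hdet
    simpa [Matrix.mul_apply, Fin.sum_univ_two] using h0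
  · exact of_ne g hg

theorem mem_span_of_pow_eight_eq (h2 : (2 : K) = 0) {a t : K} (ha : a ^ 3 = a + 1)
    (ht : t ^ 8 = t) :
    t = 0 ∨ t = 1 ∨ t = a ∨ t = a + 1 ∨ t = a ^ 2 ∨ t = a ^ 2 + 1 ∨ t = a ^ 2 + a ∨
      t = a ^ 2 + a + 1 := by
  have h : t * (t - 1) * (t - a) * (t - (a + 1)) * (t - a ^ 2) * (t - (a ^ 2 + 1)) *
      (t - (a ^ 2 + a)) * (t - (a ^ 2 + a + 1)) = 0 := by grind
  simpa [sub_eq_zero, or_assoc] using h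

theorem exists_root (h2 : (2 : K) = 0) (hK : Nat.card K = 8) : ∃ a : K, a ^ 3 = a + 1 := by
  have : Finite K := Nat.finite_of_card_ne_zero (by lia)
  have := Fintype.ofFinite K
  classical
  obtain ⟨b, -, hb⟩ := Finset.exists_mem_notMem_of_card_lt_card
    (s := ({0, 1} : Finset K)) (t := Finset.univ)
    (by rw [Finset.card_univ, ← Nat.card_eq_fintype_card, hK]
        exact Finset.card_le_two.trans_lt (by norm_num))
  have h8 : b ^ 8 = b := by
    have := FiniteField.pow_card b
    rwa [← Nat.card_eq_fintype_card, hK] at this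
  simp only [Finset.mem_insert, Finset.mem_singleton, not_or] at hb
  have h : b * (b - 1) * (b ^ 3 - (b + 1)) * ((b + 1) ^ 3 - (b + 1 + 1)) = 0 := by grind
  have h1 : b - 1 ≠ 0 := sub_ne_zero.2 hb.2
  rcases mul_eq_zero.1 h with h | h
  · exact ⟨b, sub_eq_zero.1 (by simpa [hb.1, h1] using h)⟩
  · exact ⟨b + 1, sub_eq_zero.1 h⟩

theorem swap_mul_swap (h2 : (2 : K) = 0) : swap h2 * swap h2 = 1 := by
  ext i j
  fin_cases i <;> fin_cases j <;> simp

theorem orderOf_swap (h2 : (2 : K) = 0) : orderOf (swap h2) = 2 := by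
  refine orderOf_eq_prime (by rw [pow_two, swap_mul_swap]) fun h => ?_
  simpa using congrArg (fun g : SpecialLinearGroup (Fin 2) K => g 0 1) h

theorem triple_pow_three (h2 : (2 : K) = 0) {a : K} (ha : a ^ 3 = a + 1) :
    triple h2 ha ^ 3 = 1 := by
  ext i j
  fin_cases i <;> fin_cases j <;> simp [pow_succ] <;> grind

theorem orderOf_triple (h2 : (2 : K) = 0) {a : K} (ha : a ^ 3 = a + 1) :
    orderOf (triple h2 ha) = 3 := by
  refine orderOf_eq_prime (triple_pow_three h2 ha) fun h => ?_
  have h' : a ^ 2 = 0 := by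
    simpa using congrArg (fun g : SpecialLinearGroup (Fin 2) K => g 1 0) h
  grind

theorem coe_swap_mul_triple_pow_three (h2 : (2 : K) = 0) {a : K} (ha : a ^ 3 = a + 1) :
    (((swap h2 * triple h2 ha) ^ 3 : SpecialLinearGroup (Fin 2) K) :
      Matrix (Fin 2) (Fin 2) K) = !![0, a ^ 2 + a; a + 1, 1] := by
  ext i j
  fin_cases i <;> fin_cases j <;> simp [pow_succ] <;> grind

theorem orderOf_swap_mul_triple (h2 : (2 : K) = 0) {a : K} (ha : a ^ 3 = a + 1) :
    orderOf (swap h2 * triple h2 ha) = 9 := by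
  have h3 := coe_swap_mul_triple_pow_three h2 ha
  refine orderOf_eq_prime_pow (p := 3) (n := 1) (fun h => ?_) ?_
  · rw [pow_one] at h
    simpa using congrFun₂ (h3.symm.trans (congrArg Subtype.val h)) 0 0
  · rw [pow_succ, pow_one, pow_mul]
    generalize (swap h2 * triple h2 ha) ^ 3 = g at h3 ⊢
    ext i j
    fin_cases i <;> fin_cases j <;> simp [pow_succ, h3] <;> grind

theorem coe_triple_mul_swap_mul_inv (h2 : (2 : K) = 0) {a : K} (ha : a ^ 3 = a + 1) :
    ((triple h2 ha * swap h2 * (triple h2 ha)⁻¹ : SpecialLinearGroup (Fin 2) K) :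
      Matrix (Fin 2) (Fin 2) K) = !![1, 0; a ^ 2 + 1, 1] := by
  ext i j
  fin_cases i <;> fin_cases j <;> simp [adjugate_fin_two] <;> grind

theorem coe_inv_mul_swap_mul_triple (h2 : (2 : K) = 0) {a : K} (ha : a ^ 3 = a + 1) :
    (((triple h2 ha)⁻¹ * swap h2 * triple h2 ha : SpecialLinearGroup (Fin 2) K) :
      Matrix (Fin 2) (Fin 2) K) = !![a + 1, 1; a ^ 2, a + 1] := by
  ext i j
  fin_cases i <;> fin_cases j <;> simp [adjugate_fin_two] <;> grind

theorem upper_mem (h2 : (2 : K) = 0) {a : K} (ha : a ^ 3 = a + 1)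
    {H : Subgroup (SpecialLinearGroup (Fin 2) K)} (hs : swap h2 ∈ H) (ht : triple h2 ha ∈ H)
    {t : K} (h8 : t ^ 8 = t) : upper t ∈ H := by
  set l := triple h2 ha * swap h2 * (triple h2 ha)⁻¹
  set m := (triple h2 ha)⁻¹ * swap h2 * triple h2 ha
  have hlc : (l : Matrix (Fin 2) (Fin 2) K) = _ := coe_triple_mul_swap_mul_inv h2 ha
  have hmc : (m : Matrix (Fin 2) (Fin 2) K) = _ := coe_inv_mul_swap_mul_triple h2 ha
  have hlH : l ∈ H := H.mul_mem (H.mul_mem ht hs) (H.inv_mem ht)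
  have hmH : m ∈ H := H.mul_mem (H.mul_mem (H.inv_mem ht) hs) ht
  clear_value l m
  have h₁ : upper (a ^ 2 + 1) ∈ H := by
    have : upper (a ^ 2 + 1) = swap h2 * l * swap h2 := by
      ext i j
      fin_cases i <;> fin_cases j <;> simp [hlc]
    rw [this]
    exact H.mul_mem (H.mul_mem hs hlH) hs
  have h₂ : upper (a + 1) ∈ H := by
    have : upper (a + 1) = m * swap h2 * m * swap h2 * m := by
      ext i j
      fin_cases i <;> fin_cases j <;> simp [hmc] <;> grind
    rw [this]
    exact H.mul_mem (H.mul_mem (H.mul_mem (H.mul_mem hmH hs) hmH) hs) hmH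
  have h₃ : upper (a ^ 2) ∈ H := by
    have : upper (a ^ 2) = l * swap h2 * m * swap h2 * l := by
      ext i j
      fin_cases i <;> fin_cases j <;> simp [hlc, hmc] <;> grind
    rw [this]
    exact H.mul_mem (H.mul_mem (H.mul_mem (H.mul_mem hlH hs) hmH) hs) hlH
  have add_mem {s t u : K} (hs : upper s ∈ H) (ht : upper t ∈ H) (hu : s + t = u) :
      upper u ∈ H := by
    rw [← hu, ← upper_mul_upper]
    exact H.mul_mem hs ht
  have one : upper (1 : K) ∈ H := add_mem h₁ h₃ (by grind)
  have root : upper a ∈ H := add_mem h₂ one (by grind)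
  rcases mem_span_of_pow_eight_eq h2 ha h8 with
    rfl | rfl | rfl | rfl | rfl | rfl | rfl | rfl
  · exact add_mem one one (by grind)
  · exact one
  · exact root
  · exact h₂
  · exact h₃
  · exact h₁
  · exact add_mem h₃ root rfl
  · exact add_mem (add_mem h₃ root rfl) one rfl

end SL28

open SL28 in
/-- In SL(2, F_8), the special linear group over the field with 8 elements,
there exist elements x, y, z of orders exactly 2, 3, 9 with x*y*z = 1
generating the whole group. -/
theorem sl_2_8_generating_vector_2_3_9 :
    ∃ x y z : Matrix.SpecialLinearGroup (Fin 2) (GaloisField 2 3),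
      orderOf x = 2 ∧ orderOf y = 3 ∧ orderOf z = 9 ∧
      x * y * z = 1 ∧ Subgroup.closure {x, y, z} = ⊤ := by
  have h2 : (2 : GaloisField 2 3) = 0 := CharTwo.two_eq_zero
  have hK : Nat.card (GaloisField 2 3) = 8 := GaloisField.card 2 3 (by norm_num)
  obtain ⟨a, ha⟩ := exists_root h2 hK
  refine ⟨swap h2, triple h2 ha, (swap h2 * triple h2 ha)⁻¹, orderOf_swap h2,
    orderOf_triple h2 ha, by rw [orderOf_inv, orderOf_swap_mul_triple], mul_inv_cancel _, ?_⟩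
  refine closure_eq_top_of_upper_mem h2 _ (Subgroup.subset_closure (by simp)) fun t =>
    upper_mem h2 ha (Subgroup.subset_closure (by simp)) (Subgroup.subset_closure (by simp)) ?_
  have := Fintype.ofFinite (GaloisField 2 3)
  rw [← hK, Nat.card_eq_fintype_card, FiniteField.pow_card]
end

section
/- In the projective special linear group PSL(2, F_7) (the quotient of SL(2, Z/7Z) by its center, a simple group of order 168), there exist elements x, y, z of orders exactly 3, 4, and 7 respectively such that x·y·z = 1 and x, y, z generate the whole group. -/
open Matrix in
/-- A subgroup of `SL(2, ZMod p)` containing the two standard elementary matrices is everything. -/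
theorem Matrix.SpecialLinearGroup.eq_top_of_elementary_mem {p : ℕ} [Fact p.Prime]
    (H : Subgroup (SpecialLinearGroup (Fin 2) (ZMod p)))
    (hU : ⟨!![1, 1; 0, 1], by simp⟩ ∈ H) (hL : ⟨!![1, 0; 1, 1], by simp⟩ ∈ H) : H = ⊤ := by
  have h (i j : Fin 2) (hij : i ≠ j) : SpecialLinearGroup.transvection hij (1 : ZMod p) ∈ H := by
    obtain ⟨rfl, rfl⟩ | ⟨rfl, rfl⟩ : i = 0 ∧ j = 1 ∨ i = 1 ∧ j = 0 := by omega
    · suffices SpecialLinearGroup.transvection hij (1 : ZMod p) = ⟨!![1, 1; 0, 1], by simp⟩ by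
        rwa [this]
      ext i j
      fin_cases i <;> fin_cases j <;> simp [SpecialLinearGroup.transvection_coe]
    · suffices SpecialLinearGroup.transvection hij (1 : ZMod p) = ⟨!![1, 0; 1, 1], by simp⟩ by
        rwa [this]
      ext i j
      fin_cases i <;> fin_cases j <;> simp [SpecialLinearGroup.transvection_coe]
  refine (Subgroup.eq_top_iff' H).2 fun A ↦
    SL2.transvection_induction (· ∈ H) (fun i j hij c ↦ ?_) (fun _ _ ↦ H.mul_mem) A
  have key (n : ℕ) : SpecialLinearGroup.transvection hij (n : ZMod p) ∈ H := by
    induction n with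
    | zero => simp [H.one_mem]
    | succ n ih =>
      rw [Nat.cast_succ, SpecialLinearGroup.transvection_add]
      exact H.mul_mem ih (h i j hij)
  simpa using key c.val

/-- In PSL(2, F_7), the quotient of SL(2, Z/7Z) by its center, there exist elements
x, y, z of orders exactly 3, 4, 7 with x*y*z = 1 generating the whole group. -/
theorem psl_2_7_generating_vector_3_4_7 :
    ∃ x y z : Matrix.SpecialLinearGroup (Fin 2) (ZMod 7) ⧸
        Subgroup.center (Matrix.SpecialLinearGroup (Fin 2) (ZMod 7)),
      orderOf x = 3 ∧ orderOf y = 4 ∧ orderOf z = 7 ∧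
      x * y * z = 1 ∧ Subgroup.closure {x, y, z} = ⊤ := by
  let X : Matrix.SpecialLinearGroup (Fin 2) (ZMod 7) := ⟨!![2, 0; 5, 4], by decide⟩
  let Y : Matrix.SpecialLinearGroup (Fin 2) (ZMod 7) := ⟨!![4, 3; 2, 0], by decide⟩
  let Z : Matrix.SpecialLinearGroup (Fin 2) (ZMod 7) := ⟨!![1, 1; 0, 1], by decide⟩
  let π := QuotientGroup.mk' (Subgroup.center (Matrix.SpecialLinearGroup (Fin 2) (ZMod 7)))
  have hne (A B : Matrix.SpecialLinearGroup (Fin 2) (ZMod 7)) (h : B * A ≠ A * B) : π A ≠ 1 :=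
    fun hA ↦ h (Subgroup.mem_center_iff.1 ((QuotientGroup.eq_one_iff A).1 hA) B)
  have hneg : π (-1) = 1 := (QuotientGroup.eq_one_iff _).2
    (Subgroup.mem_center_iff.2 fun g ↦ by simp)
  have hgen : Subgroup.closure {X, Y, Z} = ⊤ := by
    have hX : X ∈ Subgroup.closure {X, Y, Z} := Subgroup.subset_closure (by simp)
    have hY : Y ∈ Subgroup.closure {X, Y, Z} := Subgroup.subset_closure (by simp)
    have hZ : Z ∈ Subgroup.closure {X, Y, Z} := Subgroup.subset_closure (by simp)
    have hL : Y * X * X * Z = ⟨!![1, 0; 1, 1], by simp⟩ := Subtype.ext (by decide)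
    have : Fact (Nat.Prime 7) := ⟨by norm_num⟩
    refine Matrix.SpecialLinearGroup.eq_top_of_elementary_mem _ hZ ?_
    rw [← hL]
    exact mul_mem (mul_mem (mul_mem hY hX) hX) hZ
  refine ⟨π X, π Y, π Z, orderOf_eq_prime ?_ (hne X Z (by decide)), ?_,
    orderOf_eq_prime (hp := ⟨by norm_num⟩) ?_ (hne Z X (by decide)), ?_, ?_⟩
  · rw [← map_pow, show X ^ 3 = 1 by decide, map_one]
  · refine orderOf_eq_prime_pow (p := 2) (n := 1) ?_ ?_
    · rw [← map_pow]
      exact hne _ Z (by decide)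
    · rw [← map_pow, show Y ^ 2 ^ (1 + 1) = -1 by decide, hneg]
  · rw [← map_pow, show Z ^ 7 = 1 by decide, map_one]
  · rw [← map_mul, ← map_mul, show X * Y * Z = 1 by decide, map_one]
  · rw [← Subgroup.map_top_of_surjective π (QuotientGroup.mk'_surjective _), ← hgen,
      MonoidHom.map_closure, Set.image_insert_eq, Set.image_pair]
end

section
/- In the symmetric group S_5 on five letters, there exist permutations x, y, z of orders exactly 3, 4, and 6 respectively such that x·y·z = 1 and x, y, z generate S_5. -/
open Equiv in
/-- In the symmetric group S_5, there exist permutations x, y, z of orders exactly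
3, 4, 6 with x*y*z = 1 generating S_5. -/
theorem s5_generating_vector_3_4_6 :
    ∃ x y z : Equiv.Perm (Fin 5),
      orderOf x = 3 ∧ orderOf y = 4 ∧ orderOf z = 6 ∧
      x * y * z = 1 ∧ Subgroup.closure {x, y, z} = ⊤ := by
  refine ⟨[2, 3, 4].formPerm, [0, 1, 2, 3].formPerm, [0, 3, 1].formPerm * swap 2 4,
    (orderOf_eq_iff (by decide)).2 (by decide), (orderOf_eq_iff (by decide)).2 (by decide),
    (orderOf_eq_iff (by decide)).2 (by decide), by decide, ?_⟩
  set y : Perm (Fin 5) := [0, 1, 2, 3].formPerm with hy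
  set z : Perm (Fin 5) := [0, 3, 1].formPerm * swap 2 4 with hz
  have z_cube : z ^ 3 = swap 2 4 := by rw [hz]; decide
  have y_mul_z_cube : y * z ^ 3 = [0, 1, 2, 4, 3].formPerm := by rw [hy, hz]; decide
  have generates : Subgroup.closure {y * z ^ 3, z ^ 3} = (⊤ : Subgroup (Perm (Fin 5))) := by
    refine Perm.closure_prime_cycle_swap (by norm_num) ?_ ?_ ⟨2, 4, by decide, z_cube⟩
    · rw [y_mul_z_cube]
      exact List.isCycle_formPerm (by decide) (by decide)
    · rw [y_mul_z_cube]
      decide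
  rw [eq_top_iff, ← generates, Subgroup.closure_le]
  have hy_mem : y ∈ Subgroup.closure {[2, 3, 4].formPerm, y, z} :=
    Subgroup.subset_closure (by simp)
  have hz_mem : z ∈ Subgroup.closure {[2, 3, 4].formPerm, y, z} :=
    Subgroup.subset_closure (by simp)
  rintro g (rfl | rfl)
  · exact mul_mem hy_mem (pow_mem hz_mem 3)
  · exact pow_mem hz_mem 3
end

section
/- In the direct product C_2 × S_5 of the cyclic group of order 2 with the symmetric group on five letters, there exist elements x, y, z of orders exactly 2, 4, and 6 respectively such that x·y·z = 1 and x, y, z generate the whole group. -/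
/-- A subgroup of `A × G` which surjects onto `G` and contains `A × 1` is the whole group. -/
theorem Subgroup.eq_top_of_map_snd_eq_top {A G : Type*} [Group A] [Group G]
    {H : Subgroup (A × G)} (hsnd : H.map (MonoidHom.snd A G) = ⊤)
    (hfst : ∀ a : A, (a, 1) ∈ H) : H = ⊤ := by
  refine (Subgroup.eq_top_iff' H).2 fun ⟨a, g⟩ => ?_
  obtain ⟨⟨b, g'⟩, hb, rfl⟩ : g ∈ H.map (MonoidHom.snd A G) := hsnd ▸ Subgroup.mem_top g
  simpa using H.mul_mem (hfst (a * b⁻¹)) hb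

set_option maxRecDepth 10000 in
/-- In C_2 × S_5, there exist elements x, y, z of orders exactly 2, 4, 6 with
x*y*z = 1 generating the whole group. -/
theorem c2_x_s5_generating_vector_2_4_6 :
    ∃ x y z : Multiplicative (ZMod 2) × Equiv.Perm (Fin 5),
      orderOf x = 2 ∧ orderOf y = 4 ∧ orderOf z = 6 ∧
      x * y * z = 1 ∧ Subgroup.closure {x, y, z} = ⊤ := by
  let t : Multiplicative (ZMod 2) := Multiplicative.ofAdd 1
  let x : Multiplicative (ZMod 2) × Equiv.Perm (Fin 5) :=
    (t, Equiv.swap 0 2 * Equiv.swap 3 4)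
  let y : Multiplicative (ZMod 2) × Equiv.Perm (Fin 5) :=
    (1, Equiv.swap 0 1 * Equiv.swap 1 2 * Equiv.swap 2 3)
  let z : Multiplicative (ZMod 2) × Equiv.Perm (Fin 5) := (x * y)⁻¹
  refine ⟨x, y, z, (orderOf_eq_iff (by norm_num)).2 (by decide),
    (orderOf_eq_iff (by norm_num)).2 (by decide),
    (orderOf_eq_iff (by norm_num)).2 (by decide), mul_inv_cancel _, ?_⟩
  set H := Subgroup.closure {x, y, z}
  have hx : x ∈ H := Subgroup.subset_closure (by simp)
  have hy : y ∈ H := Subgroup.subset_closure (by simp)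
  have hz : z ∈ H := Subgroup.subset_closure (by simp)
  apply Subgroup.eq_top_of_map_snd_eq_top
  · rw [eq_top_iff, ← Equiv.Perm.closure_prime_cycle_swap (σ := finRotate 5)
      (τ := Equiv.swap 0 1) (by norm_num) isCycle_finRotate support_finRotate
      ⟨0, 1, by decide, rfl⟩, Subgroup.closure_le, Set.pair_subset_iff]
    exact ⟨⟨(y * x * z) ^ 3, H.pow_mem (H.mul_mem (H.mul_mem hy hx) hz) 3, by decide⟩,
      ⟨z ^ 3, H.pow_mem hz 3, by decide⟩⟩
  · have ht : (t, 1) ∈ H := by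
      have h : (x * y ^ 2) ^ 3 = (t, 1) := by decide
      exact h ▸ H.pow_mem (H.mul_mem hx (H.pow_mem hy 2)) 3
    intro a
    obtain rfl | rfl : a = 1 ∨ a = t := by revert a; decide
    · exact H.one_mem
    · exact ht
end

section
/- In the symmetric group S_4 on four letters, there exist permutations g_1, g_2, g_3, g_4 with g_1, g_2, g_3 of order exactly 2 and g_4 of order exactly 3, such that g_1·g_2·g_3·g_4 = 1 and g_1, g_2, g_3, g_4 generate S_4. -/
/-- In S_4, there exist permutations g1, g2, g3, g4 with g1, g2, g3 of order exactly 2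
and g4 of order exactly 3, with g1*g2*g3*g4 = 1, generating S_4. -/
theorem s4_generating_vector_2_2_2_3 :
    ∃ g1 g2 g3 g4 : Equiv.Perm (Fin 4),
      orderOf g1 = 2 ∧ orderOf g2 = 2 ∧ orderOf g3 = 2 ∧ orderOf g4 = 3 ∧
      g1 * g2 * g3 * g4 = 1 ∧ Subgroup.closure {g1, g2, g3, g4} = ⊤ := by
  refine ⟨Equiv.swap 0 1, Equiv.swap 1 2, Equiv.swap 0 1 * Equiv.swap 2 3,
    Equiv.swap 0 1 * Equiv.swap 2 3 * Equiv.swap 1 2 * Equiv.swap 0 1,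
    orderOf_eq_prime (by decide) (by decide), orderOf_eq_prime (by decide) (by decide),
    orderOf_eq_prime (by decide) (by decide), orderOf_eq_prime (by decide) (by decide),
    by decide, ?_⟩
  set H : Subgroup (Equiv.Perm (Fin 4)) := Subgroup.closure _
  have h01 : Equiv.swap 0 1 ∈ H := Subgroup.subset_closure (by simp)
  have h12 : Equiv.swap 1 2 ∈ H := Subgroup.subset_closure (by simp)
  have h23 : Equiv.swap 2 3 ∈ H :=
    (H.mul_mem_cancel_left h01).mp (Subgroup.subset_closure (by simp))
  have hle : Submonoid.closure
      (Set.range fun i : Fin 3 ↦ Equiv.swap i.castSucc i.succ) ≤ H.toSubmonoid := by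
    rw [Submonoid.closure_le]
    rintro _ ⟨i, rfl⟩
    fin_cases i
    exacts [h01, h12, h23]
  rw [Equiv.Perm.mclosure_swap_castSucc_succ] at hle
  exact eq_top_iff.mpr fun _ _ ↦ hle trivial
end

section
/- In the alternating group A_4 on four letters, there exist permutations g_1, g_2, g_3, g_4 with g_1 of order exactly 2 and g_2, g_3, g_4 each of order exactly 3, such that g_1·g_2·g_3·g_4 = 1 and g_1, g_2, g_3, g_4 generate A_4. -/
theorem alternatingGroup_four_eq_pow_mul_pow_mul_pow :
    ∀ x : Equiv.Perm (Fin 4), Equiv.Perm.sign x = 1 →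
      ∃ i : Fin 3, ∃ e : Fin 2, ∃ j : Fin 3,
        x = c[0, 1, 2] ^ (i : ℕ) * (c[0, 1] * c[2, 3]) ^ (e : ℕ) * c[0, 1, 2] ^ (j : ℕ) := by
  decide +kernel

/-- In A_4, there exist elements g1, g2, g3, g4 with g1 of order exactly 2 and
g2, g3, g4 each of order exactly 3, with g1*g2*g3*g4 = 1, generating A_4. -/
theorem a4_generating_vector_2_3_3_3 :
    ∃ g1 g2 g3 g4 : alternatingGroup (Fin 4),
      orderOf g1 = 2 ∧ orderOf g2 = 3 ∧ orderOf g3 = 3 ∧ orderOf g4 = 3 ∧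
      g1 * g2 * g3 * g4 = 1 ∧ Subgroup.closure {g1, g2, g3, g4} = ⊤ := by
  let t : alternatingGroup (Fin 4) :=
    ⟨c[0, 1] * c[2, 3], Equiv.Perm.mem_alternatingGroup.2 (by decide +kernel)⟩
  let g : alternatingGroup (Fin 4) :=
    ⟨c[0, 1, 2], Equiv.Perm.mem_alternatingGroup.2 (by decide +kernel)⟩
  have ht : orderOf t = 2 :=
    orderOf_eq_prime (Subtype.ext (by decide +kernel)) fun h => absurd (congrArg Subtype.val h) (by decide +kernel)
  have hg : orderOf g = 3 :=
    orderOf_eq_prime (Subtype.ext (by decide +kernel)) fun h => absurd (congrArg Subtype.val h) (by decide +kernel)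
  have hgt : orderOf (g * t) = 3 :=
    orderOf_eq_prime (Subtype.ext (by decide +kernel)) fun h => absurd (congrArg Subtype.val h) (by decide +kernel)
  refine ⟨t, g, g, g * t, ht, hg, hg, hgt, Subtype.ext (by decide +kernel), ?_⟩
  refine (Subgroup.eq_top_iff' _).2 fun x => ?_
  obtain ⟨i, e, j, h⟩ :=
    alternatingGroup_four_eq_pow_mul_pow_mul_pow x (Equiv.Perm.mem_alternatingGroup.1 x.2)
  have hx : x = g ^ (i : ℕ) * t ^ (e : ℕ) * g ^ (j : ℕ) := Subtype.ext h
  have mt : t ∈ Subgroup.closure {t, g, g, g * t} := Subgroup.subset_closure (by simp)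
  have mg : g ∈ Subgroup.closure {t, g, g, g * t} := Subgroup.subset_closure (by simp)
  rw [hx]
  exact mul_mem (mul_mem (pow_mem mg _) (pow_mem mt _)) (pow_mem mg _)
end

section
/- In the direct product S_3 × S_3 of two copies of the symmetric group on three letters (a group of order 36), there exist elements g_1, g_2, g_3, g_4, g_5 with g_1, g_2, g_3, g_4 each of order exactly 2 and g_5 of order exactly 6, such that g_1·g_2·g_3·g_4·g_5 = 1 and g_1, ..., g_5 generate the whole group. -/
/-- A subgroup of `S₃` containing two adjacent transpositions is the whole group. -/
theorem Subgroup.eq_top_of_swap_mem_perm_fin_three {H : Subgroup (Equiv.Perm (Fin 3))}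
    (h01 : Equiv.swap 0 1 ∈ H) (h12 : Equiv.swap 1 2 ∈ H) : H = ⊤ := by
  have key : ∀ x : Equiv.Perm (Fin 3),
      x = 1 ∨ x = Equiv.swap 0 1 ∨ x = Equiv.swap 1 2 ∨
      x = Equiv.swap 0 1 * Equiv.swap 1 2 ∨ x = Equiv.swap 1 2 * Equiv.swap 0 1 ∨
      x = Equiv.swap 0 1 * Equiv.swap 1 2 * Equiv.swap 0 1 := by decide
  refine (Subgroup.eq_top_iff' H).2 fun x => ?_
  rcases key x with rfl | rfl | rfl | rfl | rfl | rfl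
  exacts [H.one_mem, h01, h12, H.mul_mem h01 h12, H.mul_mem h12 h01,
    H.mul_mem (H.mul_mem h01 h12) h01]

/-- A subgroup of `G × H` containing both factors is the whole group. -/
theorem Subgroup.eq_top_of_comap_inl_of_comap_inr {G H : Type*} [Group G] [Group H]
    {K : Subgroup (G × H)} (hl : K.comap (MonoidHom.inl G H) = ⊤)
    (hr : K.comap (MonoidHom.inr G H) = ⊤) : K = ⊤ := by
  refine (Subgroup.eq_top_iff' K).2 fun x => ?_
  have h1 : (x.1, 1) ∈ K := (Subgroup.eq_top_iff' _).1 hl x.1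
  have h2 : (1, x.2) ∈ K := (Subgroup.eq_top_iff' _).1 hr x.2
  simpa using K.mul_mem h1 h2

/-- In S_3 × S_3, there exist elements g1, ..., g5 with g1, g2, g3, g4 each of order
exactly 2 and g5 of order exactly 6, with g1*g2*g3*g4*g5 = 1, generating the whole group. -/
theorem s3_x_s3_generating_vector_2_2_2_2_6 :
    ∃ g1 g2 g3 g4 g5 : Equiv.Perm (Fin 3) × Equiv.Perm (Fin 3),
      orderOf g1 = 2 ∧ orderOf g2 = 2 ∧ orderOf g3 = 2 ∧ orderOf g4 = 2 ∧
      orderOf g5 = 6 ∧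
      g1 * g2 * g3 * g4 * g5 = 1 ∧ Subgroup.closure {g1, g2, g3, g4, g5} = ⊤ := by
  refine ⟨(Equiv.swap 0 1, 1), (Equiv.swap 1 2, Equiv.swap 0 1), (1, Equiv.swap 1 2),
    (1, Equiv.swap 0 1),
    (Equiv.swap 1 2 * Equiv.swap 0 1, Equiv.swap 0 1 * Equiv.swap 1 2 * Equiv.swap 0 1),
    orderOf_eq_prime (by decide) (by decide), orderOf_eq_prime (by decide) (by decide),
    orderOf_eq_prime (by decide) (by decide), orderOf_eq_prime (by decide) (by decide),
    (orderOf_eq_iff (by norm_num)).2 ⟨by decide, by decide⟩, by decide, ?_⟩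
  apply Subgroup.eq_top_of_comap_inl_of_comap_inr <;>
    apply Subgroup.eq_top_of_swap_mem_perm_fin_three <;>
    simp only [Subgroup.mem_comap, MonoidHom.inl_apply, MonoidHom.inr_apply]
  · exact Subgroup.subset_closure (by simp)
  · rw [show ((Equiv.swap 1 2, 1) : Equiv.Perm (Fin 3) × Equiv.Perm (Fin 3)) =
      (Equiv.swap 1 2, Equiv.swap 0 1) * (1, Equiv.swap 0 1) by decide]
    exact Subgroup.mul_mem _ (Subgroup.subset_closure (by simp))
      (Subgroup.subset_closure (by simp))
  · exact Subgroup.subset_closure (by simp)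
  · exact Subgroup.subset_closure (by simp)
end

section
/- In the dihedral group of order 12 (the symmetry group of a regular hexagon), there exist elements g_1, g_2, g_3, g_4 with g_1, g_2, g_3 of order exactly 2 and g_4 of order exactly 6, such that g_1·g_2·g_3·g_4 = 1 and g_1, g_2, g_3, g_4 generate the whole group. -/
/-- In the dihedral group of order 12, there exist elements g1, g2, g3, g4 with
g1, g2, g3 of order exactly 2 and g4 of order exactly 6, with g1*g2*g3*g4 = 1,
generating the whole group. -/
theorem d6_generating_vector_2_2_2_6 :
    ∃ g1 g2 g3 g4 : DihedralGroup 6,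
      orderOf g1 = 2 ∧ orderOf g2 = 2 ∧ orderOf g3 = 2 ∧ orderOf g4 = 6 ∧
      g1 * g2 * g3 * g4 = 1 ∧ Subgroup.closure {g1, g2, g3, g4} = ⊤ := by
  have hr : DihedralGroup.r 1 ∈ Subgroup.closure
      {.r 3, .sr 0, .sr 2, (.r 1 : DihedralGroup 6)} := Subgroup.subset_closure (by simp)
  have hs : DihedralGroup.sr 0 ∈ Subgroup.closure
      {.r 3, .sr 0, .sr 2, (.r 1 : DihedralGroup 6)} := Subgroup.subset_closure (by simp)
  refine ⟨.r 3, .sr 0, .sr 2, .r 1, orderOf_eq_prime (by decide) (by decide),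
    DihedralGroup.orderOf_sr 0, DihedralGroup.orderOf_sr 2, DihedralGroup.orderOf_r_one,
    by decide, (Subgroup.eq_top_iff' _).2 ?_⟩
  have hrot (i : ZMod 6) : DihedralGroup.r i ∈ Subgroup.closure
      {.r 3, .sr 0, .sr 2, (.r 1 : DihedralGroup 6)} := by
    simpa using pow_mem hr i.val
  rintro (i | i)
  · exact hrot i
  · simpa using mul_mem hs (hrot i)
end

section
/- In the direct product C_2 × S_4 of the cyclic group of order 2 with the symmetric group on four letters, there exist elements g_1, g_2, g_3, g_4 of orders exactly 2, 2, 4, and 6 respectively, such that g_1·g_2·g_3·g_4 = 1 and g_1, g_2, g_3, g_4 generate the whole group. -/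
open Equiv in
/-- The adjacent transposition `swap 0 1` and the `4`-cycle `finRotate 4` generate `S_4`. -/
theorem closure_finRotate_four_swap :
    Subgroup.closure ({finRotate 4, swap 0 1} : Set (Perm (Fin 4))) = ⊤ :=
  Perm.closure_cycle_adjacent_swap isCycle_finRotate support_finRotate 0

/-- In C_2 × S_4, there exist elements g1, g2, g3, g4 of orders exactly 2, 2, 4, 6
with g1*g2*g3*g4 = 1, generating the whole group. -/
theorem c2_x_s4_generating_vector_2_2_4_6 :
    ∃ g1 g2 g3 g4 : Multiplicative (ZMod 2) × Equiv.Perm (Fin 4),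
      orderOf g1 = 2 ∧ orderOf g2 = 2 ∧ orderOf g3 = 4 ∧ orderOf g4 = 6 ∧
      g1 * g2 * g3 * g4 = 1 ∧ Subgroup.closure {g1, g2, g3, g4} = ⊤ := by
  refine ⟨(.ofAdd 1, 1), (1, Equiv.swap 0 1), (1, finRotate 4),
    (.ofAdd 1, (Equiv.swap 0 1 * finRotate 4)⁻¹), ?_, ?_, ?_, ?_, by decide, ?_⟩
  · exact orderOf_eq_prime (by decide) (by decide)
  · exact orderOf_eq_prime (by decide) (by decide)
  · rw [orderOf_eq_iff (by norm_num)]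
    exact ⟨by decide, fun m hm hm0 ↦ by interval_cases m <;> decide⟩
  · rw [orderOf_eq_iff (by norm_num)]
    exact ⟨by decide, fun m hm hm0 ↦ by interval_cases m <;> decide⟩
  · let H : Subgroup (Multiplicative (ZMod 2) × Equiv.Perm (Fin 4)) :=
      Subgroup.closure {(.ofAdd 1, 1), (1, Equiv.swap 0 1), (1, finRotate 4),
        (.ofAdd 1, (Equiv.swap 0 1 * finRotate 4)⁻¹)}
    have hz : ((.ofAdd 1, 1) : Multiplicative (ZMod 2) × Equiv.Perm (Fin 4)) ∈ H :=
      Subgroup.subset_closure (by simp)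
    have hS : (⊤ : Subgroup (Equiv.Perm (Fin 4))) ≤
        H.comap (MonoidHom.inr (Multiplicative (ZMod 2)) (Equiv.Perm (Fin 4))) := by
      rw [← closure_finRotate_four_swap, Subgroup.closure_le]
      rintro p (rfl | rfl) <;> exact Subgroup.subset_closure (by simp)
    have hC : ∀ a : Multiplicative (ZMod 2), a = 1 ∨ a = .ofAdd 1 := by decide
    change H = ⊤
    refine eq_top_iff.mpr ?_
    rintro ⟨a, p⟩ -
    have hp : ((1, p) : Multiplicative (ZMod 2) × Equiv.Perm (Fin 4)) ∈ H :=
      hS (Subgroup.mem_top p)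
    rcases hC a with rfl | rfl
    · exact hp
    · simpa using H.mul_mem hz hp
end

section
/- In the direct product C_2 × A_4 of the cyclic group of order 2 with the alternating group on four letters, there exist elements g_1, g_2, g_3, g_4 of orders exactly 2, 2, 3, and 6 respectively, such that g_1·g_2·g_3·g_4 = 1 and g_1, g_2, g_3, g_4 generate the whole group. -/
/-- In C_2 × A_4, there exist elements g1, g2, g3, g4 of orders exactly 2, 2, 3, 6
with g1*g2*g3*g4 = 1, generating the whole group. -/
theorem c2_x_a4_generating_vector_2_2_3_6 :
    ∃ g1 g2 g3 g4 : Multiplicative (ZMod 2) × alternatingGroup (Fin 4),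
      orderOf g1 = 2 ∧ orderOf g2 = 2 ∧ orderOf g3 = 3 ∧ orderOf g4 = 6 ∧
      g1 * g2 * g3 * g4 = 1 ∧ Subgroup.closure {g1, g2, g3, g4} = ⊤ := by
  let v : alternatingGroup (Fin 4) := ⟨Equiv.swap 0 1 * Equiv.swap 2 3,
    Equiv.Perm.mem_alternatingGroup.2 (by decide)⟩
  let t : alternatingGroup (Fin 4) := ⟨Equiv.swap 0 1 * Equiv.swap 1 2,
    Equiv.Perm.mem_alternatingGroup.2 (by decide)⟩
  let c : Multiplicative (ZMod 2) := Multiplicative.ofAdd 1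
  refine ⟨(1, v), (c, 1), (1, t), (c, (v * t)⁻¹), ?_, ?_, ?_, ?_, by decide, ?_⟩
  · exact orderOf_eq_prime (by decide) (by decide)
  · exact orderOf_eq_prime (by decide) (by decide)
  · exact orderOf_eq_prime (by decide) (by decide)
  · rw [Prod.orderOf_mk, orderOf_eq_prime (p := 2) (x := c) (by decide) (by decide),
      orderOf_eq_prime (p := 3) (x := (v * t)⁻¹) (by decide) (by decide)]
    rfl
  · -- `A₄` is the union of `⟨t⟩` and the double coset `⟨t⟩ v ⟨t⟩`.
    have hA : ∀ x : alternatingGroup (Fin 4), ∃ i : Fin 3, ∃ j : Fin 2, ∃ k : Fin 3,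
        x = t ^ (i : ℕ) * v ^ (j : ℕ) * t ^ (k : ℕ) := by decide
    have hC : ∀ y : Multiplicative (ZMod 2), ∃ a : Fin 2, y = c ^ (a : ℕ) := by decide
    rw [eq_top_iff]
    rintro ⟨y, x⟩ -
    obtain ⟨a, rfl⟩ := hC y
    obtain ⟨i, j, k, rfl⟩ := hA x
    have key : ((c ^ (a : ℕ), t ^ (i : ℕ) * v ^ (j : ℕ) * t ^ (k : ℕ)) :
        Multiplicative (ZMod 2) × alternatingGroup (Fin 4)) =
        (c, 1) ^ (a : ℕ) * ((1, t) ^ (i : ℕ) * (1, v) ^ (j : ℕ) * (1, t) ^ (k : ℕ)) := by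
      simp
    rw [key]
    have hmem := Subgroup.subset_closure (G := Multiplicative (ZMod 2) × alternatingGroup (Fin 4))
      (k := {(1, v), (c, 1), (1, t), (c, (v * t)⁻¹)})
    exact mul_mem (pow_mem (hmem (by simp)) _) (mul_mem (mul_mem (pow_mem (hmem (by simp)) _)
      (pow_mem (hmem (by simp)) _)) (pow_mem (hmem (by simp)) _))
end

section
/- In the dihedral group of order 8 (the symmetry group of a square), there exist elements g_1, g_2, g_3, g_4, g_5 with g_1, g_2, g_3, g_4 each of order exactly 2 and g_5 of order exactly 4, such that g_1·g_2·g_3·g_4·g_5 = 1 and g_1, ..., g_5 generate the whole group. -/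
/-- A rotation of order `n` and a reflection generate the dihedral group. -/
theorem DihedralGroup.closure_eq_top_of_r_one_mem_of_sr_zero_mem {n : ℕ}
    {S : Set (DihedralGroup n)} (hr : DihedralGroup.r 1 ∈ S) (hs : DihedralGroup.sr 0 ∈ S) :
    Subgroup.closure S = ⊤ := by
  have rot (i : ZMod n) : DihedralGroup.r i ∈ Subgroup.closure S := by
    obtain ⟨k, rfl⟩ := ZMod.intCast_surjective i
    rw [← DihedralGroup.r_one_zpow]
    exact zpow_mem (Subgroup.subset_closure hr) k
  refine (Subgroup.eq_top_iff' _).mpr fun x => ?_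
  cases x with
  | r i => exact rot i
  | sr i => simpa using mul_mem (Subgroup.subset_closure hs) (rot i)

/-- In the dihedral group of order 8, there exist elements g1, ..., g5 with
g1, g2, g3, g4 each of order exactly 2 and g5 of order exactly 4, with
g1*g2*g3*g4*g5 = 1, generating the whole group. -/
theorem d4_generating_vector_2_2_2_2_4 :
    ∃ g1 g2 g3 g4 g5 : DihedralGroup 4,
      orderOf g1 = 2 ∧ orderOf g2 = 2 ∧ orderOf g3 = 2 ∧ orderOf g4 = 2 ∧
      orderOf g5 = 4 ∧
      g1 * g2 * g3 * g4 * g5 = 1 ∧ Subgroup.closure {g1, g2, g3, g4, g5} = ⊤ := by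
  refine ⟨.sr 0, .sr 0, .sr 0, .sr 3, .r 1, DihedralGroup.orderOf_sr 0,
    DihedralGroup.orderOf_sr 0, DihedralGroup.orderOf_sr 0, DihedralGroup.orderOf_sr 3,
    DihedralGroup.orderOf_r_one, by decide, ?_⟩
  exact DihedralGroup.closure_eq_top_of_r_one_mem_of_sr_zero_mem (by simp) (by simp)
end

section
/- In the direct product D_4 × C_2 of the dihedral group of order 8 with the cyclic group of order 2 (a group of order 16), there exist elements g_1, g_2, g_3, g_4 with g_1, g_2, g_3 of order exactly 2 and g_4 of order exactly 4, such that g_1·g_2·g_3·g_4 = 1 and g_1, g_2, g_3, g_4 generate the whole group. -/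
/-- In D_4 × C_2 (order 16), there exist elements g1, g2, g3, g4 with g1, g2, g3 of
order exactly 2 and g4 of order exactly 4, with g1*g2*g3*g4 = 1, generating the
whole group. -/
theorem d4_x_c2_generating_vector_2_2_2_4 :
    ∃ g1 g2 g3 g4 : DihedralGroup 4 × Multiplicative (ZMod 2),
      orderOf g1 = 2 ∧ orderOf g2 = 2 ∧ orderOf g3 = 2 ∧ orderOf g4 = 4 ∧
      g1 * g2 * g3 * g4 = 1 ∧ Subgroup.closure {g1, g2, g3, g4} = ⊤ := by
  refine ⟨(.sr 0, 1), (.sr 1, 1), (1, .ofAdd 1), (.r 3, .ofAdd 1),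
    orderOf_eq_prime (by decide) (by decide), orderOf_eq_prime (by decide) (by decide),
    orderOf_eq_prime (by decide) (by decide),
    orderOf_eq_prime_pow (p := 2) (n := 1) (by decide) (by decide), by decide, ?_⟩
  refine (Subgroup.eq_top_iff' _).2 fun x => ?_
  have normal_form : ∀ x : DihedralGroup 4 × Multiplicative (ZMod 2),
      ∃ (a : Fin 2) (b : Fin 4) (c : Fin 2),
        (.sr 0, 1) ^ (a : ℕ) * ((.sr 0, 1) * (.sr 1, 1)) ^ (b : ℕ) *
          (1, .ofAdd 1) ^ (c : ℕ) = x := by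
    rintro ⟨i | i, k⟩ <;> revert i k <;> decide
  obtain ⟨a, b, c, rfl⟩ := normal_form x
  refine mul_mem (mul_mem (pow_mem ?_ _) (pow_mem (mul_mem ?_ ?_) _)) (pow_mem ?_ _) <;>
    exact Subgroup.subset_closure (by simp)
end

section
/- In the symmetric group S_4 on four letters, there exist permutations g_1, g_2, g_3, g_4 of orders exactly 2, 3, 3, and 4 respectively, such that g_1·g_2·g_3·g_4 = 1 and g_1, g_2, g_3, g_4 generate S_4. -/
/-- In S_4, there exist permutations g1, g2, g3, g4 of orders exactly 2, 3, 3, 4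
with g1*g2*g3*g4 = 1, generating S_4. -/
theorem s4_generating_vector_2_3_3_4 :
    ∃ g1 g2 g3 g4 : Equiv.Perm (Fin 4),
      orderOf g1 = 2 ∧ orderOf g2 = 3 ∧ orderOf g3 = 3 ∧ orderOf g4 = 4 ∧
      g1 * g2 * g3 * g4 = 1 ∧ Subgroup.closure {g1, g2, g3, g4} = ⊤ := by
  have h3 : orderOf (finRotate 4 * Equiv.swap 0 1) = 3 :=
    orderOf_eq_prime (by decide) (by decide)
  refine ⟨Equiv.swap 0 1, finRotate 4 * Equiv.swap 0 1, finRotate 4 * Equiv.swap 0 1,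
    finRotate 4, orderOf_eq_prime (by decide) (by decide), h3, h3,
    orderOf_eq_prime_pow (p := 2) (n := 1) (by decide) (by decide), by decide, ?_⟩
  have hgen := Equiv.Perm.closure_cycle_adjacent_swap (isCycle_finRotate (n := 2))
    support_finRotate 0
  rw [eq_top_iff, ← hgen]
  refine Subgroup.closure_mono ?_
  rintro g (rfl | rfl)
  · simp
  · exact Or.inl (by decide)
end
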